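/- Define F(z) = ∫_ℝ (λz+1)/(λ−z) · (1+sin λ)/(π(1+λ²)) dλ for Im z > 0. Then F(z) = i + e^{iz} − e^{−1} for all z in the upper half-plane; in particular F has period 2π: F(z+2π) = F(z). -/

import Mathlib

open MeasureTheory Complex Real

open Filter Bornology Asymptotics Topology

lemma tendsto_ofReal_cocompact_upperHalfPlane :
    Tendsto (fun x : ℝ => (x : ℂ)) (cocompact ℝ) (cobounded ℂ ⊓ 𝓟 {z | 0 ≤ z.im}) := by
  refine tendsto_inf.2 ⟨?_, tendsto_principal.2 (by simp)⟩
  rw [← Metric.cobounded_eq_cocompact]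
  exact RCLike.tendsto_ofReal_cobounded_cobounded ℂ

lemma Continuous.integrable_of_isBigO_inv_sq {g : ℝ → ℂ} (hg : Continuous g)
    (ho : g =O[cocompact ℝ] fun x => ((x : ℂ) ^ 2)⁻¹) : Integrable g := by
  refine hg.locallyIntegrable.integrable_of_isBigO_cocompact
    (g := fun x : ℝ => (1 + x ^ 2)⁻¹) (ho.trans ?_)
    (integrable_inv_one_add_sq.integrableAtFilter _)
  refine IsBigO.of_bound 2 ?_
  rw [← Metric.cobounded_eq_cocompact]
  filter_upwards [hasBasis_cobounded_norm.mem_of_mem (i := (1 : ℝ)) trivial] with x hx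
  have hx1 : 1 ≤ x ^ 2 := by
    rw [← sq_abs]
    have : 1 ≤ |x| := hx
    nlinarith
  rw [norm_inv, norm_pow, norm_real, Real.norm_eq_abs, sq_abs, Real.norm_eq_abs,
    abs_of_nonneg (by positivity), ← div_eq_mul_inv, inv_eq_one_div,
    div_le_div_iff₀ (by positivity) (by positivity)]
  linarith

/-- The integral over the real line of a function that is holomorphic on the closed upper half-plane
and decays quadratically vanishes. -/
lemma integral_eq_zero_of_isBigO_inv_sq {h : ℂ → ℂ}
    (hd : ∀ z : ℂ, 0 ≤ z.im → DifferentiableAt ℂ h z)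
    (ho : h =O[cobounded ℂ ⊓ 𝓟 {z | 0 ≤ z.im}] fun z => (z ^ 2)⁻¹) :
    ∫ x : ℝ, h x = 0 := by
  have hcont : Continuous fun x : ℝ => h x := continuous_iff_continuousAt.2 fun x =>
    ContinuousAt.comp' (f := fun x : ℝ => (x : ℂ)) (hd x (by simp)).continuousAt
      continuous_ofReal.continuousAt
  have hint : Integrable fun x : ℝ => h x :=
    hcont.integrable_of_isBigO_inv_sq (ho.comp_tendsto tendsto_ofReal_cocompact_upperHalfPlane)
  have hlim := intervalIntegral_tendsto_integral hint tendsto_neg_atTop_atBot tendsto_id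
  refine tendsto_nhds_unique hlim ?_
  obtain ⟨C, hC0, hC⟩ := ho.exists_pos
  obtain ⟨R₀, -, hR₀⟩ :=
    (hasBasis_cobounded_norm.inf_principal _).eventually_iff.1 hC.bound
  refine squeeze_zero_norm' (a := fun R : ℝ => 4 * C * R⁻¹) ?_
    (by simpa using tendsto_inv_atTop_zero.const_mul (4 * C))
  filter_upwards [eventually_ge_atTop R₀, eventually_gt_atTop 0] with R hR hR0
  have hbound : ∀ w : ℂ, 0 ≤ w.im → R ≤ ‖w‖ → ‖h w‖ ≤ C * (R ^ 2)⁻¹ := fun w hw hRw => by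
    refine (hR₀ ⟨hR.trans hRw, hw⟩).trans ?_
    rw [norm_inv, norm_pow]
    gcongr
  have hrect := integral_boundary_rect_eq_zero_of_differentiableOn h (-R : ℝ) (R + R * I) (by
    intro w hw
    refine (hd w ?_).differentiableWithinAt
    have := (Complex.mem_reProdIm.1 hw).2
    simp [hR0.le, Set.uIcc_of_le] at this
    exact this.1)
  simp only [ofReal_re, ofReal_im, add_re, add_im, mul_re, mul_im, I_re, I_im, mul_zero, mul_one,
    sub_self, add_zero, zero_add, ofReal_zero, zero_mul, smul_eq_mul] at hrect
  have htop : ‖∫ x : ℝ in -R..R, h (x + R * I)‖ ≤ C * (R ^ 2)⁻¹ * |R - -R| :=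
    intervalIntegral.norm_integral_le_of_norm_le_const fun x _ => by
      refine hbound _ (by simp [hR0.le]) ?_
      simpa [abs_of_pos hR0] using abs_im_le_norm ((x : ℂ) + R * I)
  have hright : ‖∫ y : ℝ in (0 : ℝ)..R, h (R + y * I)‖ ≤ C * (R ^ 2)⁻¹ * |R - 0| :=
    intervalIntegral.norm_integral_le_of_norm_le_const fun y hy => by
      rw [Set.uIoc_of_le hR0.le] at hy
      refine hbound _ (by simpa using hy.1.le) ?_
      simpa [abs_of_pos hR0] using abs_re_le_norm ((R : ℂ) + y * I)
  have hleft : ‖∫ y : ℝ in (0 : ℝ)..R, h ((-R : ℝ) + y * I)‖ ≤ C * (R ^ 2)⁻¹ * |R - 0| :=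
    intervalIntegral.norm_integral_le_of_norm_le_const fun y hy => by
      rw [Set.uIoc_of_le hR0.le] at hy
      refine hbound _ (by simpa using hy.1.le) ?_
      simpa [abs_of_pos hR0] using abs_re_le_norm (((-R : ℝ) : ℂ) + y * I)
  have hbottom : ∫ x : ℝ in -R..R, h x = (∫ x : ℝ in -R..R, h (x + R * I)) -
      I * (∫ y : ℝ in (0 : ℝ)..R, h (R + y * I)) +
      I * (∫ y : ℝ in (0 : ℝ)..R, h ((-R : ℝ) + y * I)) := by
    linear_combination hrect
  simp only [id]
  rw [hbottom]
  refine (norm_add_le _ _).trans ((add_le_add_left (norm_sub_le _ _) _).trans ?_)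
  rw [norm_mul, norm_mul, norm_I, one_mul, one_mul]
  rw [sub_neg_eq_add, abs_of_pos (by linarith)] at htop
  rw [sub_zero, abs_of_pos hR0] at hright hleft
  have : C * (R ^ 2)⁻¹ * (R + R) + C * (R ^ 2)⁻¹ * R + C * (R ^ 2)⁻¹ * R = 4 * C * R⁻¹ := by
    field_simp
    ring
  linarith

lemma inv_sub_isBigO_inv (a : ℂ) :
    (fun z : ℂ => (z - a)⁻¹) =O[cobounded ℂ] fun z => z⁻¹ := by
  have h : (fun z : ℂ => z - a) ~[cobounded ℂ] fun z => z := by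
    refine (isLittleO_const_id_cobounded (-a)).congr_left fun z => ?_
    simp
  exact h.inv.isBigO

lemma mul_inv_mul_inv_isBigO {f : ℂ → ℂ} {M : ℝ} (hb : ∀ z : ℂ, 0 ≤ z.im → ‖f z‖ ≤ M) (a b : ℂ) :
    (fun z => f z * ((z - a)⁻¹ * (z - b)⁻¹)) =O[cobounded ℂ ⊓ 𝓟 {z | 0 ≤ z.im}]
      fun z => (z ^ 2)⁻¹ := by
  have hf : f =O[cobounded ℂ ⊓ 𝓟 {z | 0 ≤ z.im}] fun _ => (1 : ℂ) :=
    IsBigO.of_bound M (mem_inf_of_right fun z hz => by simpa using hb z hz)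
  refine (hf.mul (((inv_sub_isBigO_inv a).mul (inv_sub_isBigO_inv b)).mono inf_le_left)).congr_right
    fun z => ?_
  rw [one_mul, sq, mul_inv]

lemma integrable_mul_inv_mul_inv {f : ℂ → ℂ} {M : ℝ} (hf : Continuous f)
    (hb : ∀ z : ℂ, 0 ≤ z.im → ‖f z‖ ≤ M) {a b : ℂ} (ha : a.im ≠ 0) (hb' : b.im ≠ 0) :
    Integrable fun x : ℝ => f x * (((x : ℂ) - a)⁻¹ * ((x : ℂ) - b)⁻¹) := by
  have hne : ∀ {c : ℂ}, c.im ≠ 0 → ∀ x : ℝ, (x : ℂ) - c ≠ 0 := fun hc x h =>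
    hc (by simpa using congrArg Complex.im h)
  refine Continuous.integrable_of_isBigO_inv_sq ?_
    ((mul_inv_mul_inv_isBigO hb a b).comp_tendsto tendsto_ofReal_cocompact_upperHalfPlane)
  exact (hf.comp continuous_ofReal).mul
    (((continuous_ofReal.sub continuous_const).inv₀ (hne ha)).mul
      ((continuous_ofReal.sub continuous_const).inv₀ (hne hb')))

lemma integral_mul_inv_mul_inv_eq_zero {f : ℂ → ℂ} {M : ℝ} (hf : Differentiable ℂ f)
    (hb : ∀ z : ℂ, 0 ≤ z.im → ‖f z‖ ≤ M) {a b : ℂ} (ha : a.im < 0) (hb' : b.im < 0) :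
    ∫ x : ℝ, f x * (((x : ℂ) - a)⁻¹ * ((x : ℂ) - b)⁻¹) = 0 := by
  have hne : ∀ {c : ℂ}, c.im < 0 → ∀ z : ℂ, 0 ≤ z.im → z - c ≠ 0 := fun hc z hz h => by
    rw [sub_eq_zero.1 h] at hz
    linarith
  refine integral_eq_zero_of_isBigO_inv_sq (h := fun z => f z * ((z - a)⁻¹ * (z - b)⁻¹))
    (fun z hz => ?_) (mul_inv_mul_inv_isBigO hb a b)
  exact (hf z).mul (((differentiableAt_id.sub_const a).inv (hne ha z hz)).mul
    ((differentiableAt_id.sub_const b).inv (hne hb' z hz)))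

lemma integral_mul_inv_mul_inv_eq_mul {f : ℂ → ℂ} {M : ℝ} (hf : Differentiable ℂ f)
    (hb : ∀ z : ℂ, 0 ≤ z.im → ‖f z‖ ≤ M) {a b : ℂ} (ha : 0 < a.im) (hb' : b.im < 0) :
    ∫ x : ℝ, f x * (((x : ℂ) - a)⁻¹ * ((x : ℂ) - b)⁻¹) =
      f a * ∫ x : ℝ, ((x : ℂ) - a)⁻¹ * ((x : ℂ) - b)⁻¹ := by
  have hne : ∀ x : ℝ, (x : ℂ) - a ≠ 0 := fun x h =>
    ha.ne' (by simpa using congrArg Complex.im h)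
  have hds : Differentiable ℂ (dslope f a) := by
    rw [← differentiableOn_univ, differentiableOn_dslope univ_mem]
    exact hf.differentiableOn
  have hzero : ∫ x : ℝ, dslope f a x * ((x : ℂ) - b)⁻¹ = 0 := by
    refine integral_eq_zero_of_isBigO_inv_sq (h := fun z => dslope f a z * (z - b)⁻¹)
      (fun z hz => (hds z).mul ((differentiableAt_id.sub_const b).inv fun h => ?_)) ?_
    · rw [id, sub_eq_zero] at h
      rw [h] at hz
      linarith
    · refine (mul_inv_mul_inv_isBigO (f := fun z => f z - f a) (M := M + ‖f a‖)
        (fun z hz => (norm_sub_le _ _).trans (by gcongr; exact hb z hz)) a b).congr' ?_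
        EventuallyEq.rfl
      filter_upwards [mem_inf_of_left (hasBasis_cobounded_norm.mem_of_mem
        (i := ‖a‖ + 1) trivial)] with z hz
      have hza : z ≠ a := by
        rintro rfl
        have : ‖z‖ + 1 ≤ ‖z‖ := hz
        linarith
      rw [dslope_of_ne _ hza, slope_def_field]
      ring
  have hi1 := integrable_mul_inv_mul_inv hf.continuous hb ha.ne' hb'.ne
  have hi2 : Integrable fun x : ℝ => f a * (((x : ℂ) - a)⁻¹ * ((x : ℂ) - b)⁻¹) :=
    integrable_mul_inv_mul_inv (f := fun _ => f a) (M := ‖f a‖) continuous_const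
      (fun _ _ => le_rfl) ha.ne' hb'.ne
  rw [← integral_const_mul, ← sub_eq_zero, ← integral_sub hi1 hi2, ← hzero]
  congr 1 with x
  have hxa : (x : ℂ) ≠ a := sub_ne_zero.1 (hne x)
  rw [dslope_of_ne _ hxa, slope_def_field]
  ring

lemma integral_inv_sub_I_mul_inv_add_I :
    ∫ x : ℝ, ((x : ℂ) - I)⁻¹ * ((x : ℂ) - -I)⁻¹ = π := by
  rw [← integral_univ_inv_one_add_sq, ← integral_complex_ofReal]
  congr 1 with x
  rw [← mul_inv]
  push_cast
  congr 1
  linear_combination -I_sq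

/-- The Herglotz kernel `(xz + 1) / ((x - z) (1 + x²))`. -/
noncomputable def herglotzKernel (z : ℂ) (x : ℝ) : ℂ :=
  (x * z + 1) / (x - z) * (1 + (x : ℂ) ^ 2)⁻¹

lemma herglotzKernel_eq {z : ℂ} (hz : 0 < z.im) (x : ℝ) :
    herglotzKernel z x = (z + I) * (((x : ℂ) - z)⁻¹ * ((x : ℂ) - -I)⁻¹) -
      I * (((x : ℂ) - I)⁻¹ * ((x : ℂ) - -I)⁻¹) := by
  have h1 : (x : ℂ) - z ≠ 0 := fun h => hz.ne' (by simpa using congrArg Complex.im h)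
  have h2 : (x : ℂ) - I ≠ 0 := fun h => by simpa using congrArg Complex.im h
  have h3 : (x : ℂ) - -I ≠ 0 := fun h => by simpa using congrArg Complex.im h
  have h4 : (1 : ℂ) + (x : ℂ) ^ 2 = (x - I) * (x - -I) := by linear_combination I_sq
  rw [herglotzKernel, h4]
  field_simp
  linear_combination I_sq

lemma herglotzKernel_neg_eq {z : ℂ} (hz : 0 < z.im) (x : ℝ) :
    herglotzKernel z (-x) = (z - I) * (((x : ℂ) - -z)⁻¹ * ((x : ℂ) - -I)⁻¹) +
      I * (((x : ℂ) - I)⁻¹ * ((x : ℂ) - -I)⁻¹) := by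
  have h1 : (x : ℂ) - -z ≠ 0 := fun h => hz.ne' (by simpa using congrArg Complex.im h)
  have h2 : (x : ℂ) - I ≠ 0 := fun h => by simpa using congrArg Complex.im h
  have h3 : (x : ℂ) - -I ≠ 0 := fun h => by simpa using congrArg Complex.im h
  have h4 : (1 : ℂ) + (-(x : ℂ)) ^ 2 = (x - I) * (x - -I) := by linear_combination I_sq
  have h5 : -(x : ℂ) - z = -(x - -z) := by ring
  rw [herglotzKernel, ofReal_neg, h4, h5]
  field_simp
  linear_combination -I_sq

lemma integral_inv_sub_mul_inv_add_I {a : ℂ} (ha : 0 < a.im) :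
    (a + I) * ∫ x : ℝ, ((x : ℂ) - a)⁻¹ * ((x : ℂ) - -I)⁻¹ = 2 * π * I := by
  have hb : ∀ z : ℂ, 0 ≤ z.im → ‖(1 : ℂ)‖ ≤ 1 := fun _ _ => by simp
  have hzero : ∫ x : ℝ, ((x : ℂ) - a)⁻¹ * ((x : ℂ) - I)⁻¹ = 0 := by
    rw [← integral_neg_eq_self, ← integral_mul_inv_mul_inv_eq_zero (f := fun _ => 1)
      (differentiable_const 1) hb (a := -a) (b := -I) (by simpa using ha) (by simp)]
    congr 1 with x
    rw [one_mul, ← mul_inv, ← mul_inv]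
    push_cast
    congr 1
    ring
  have hi1 : Integrable fun x : ℝ => (a + I) * (((x : ℂ) - a)⁻¹ * ((x : ℂ) - -I)⁻¹) := by
    simpa using (integrable_mul_inv_mul_inv (f := fun _ => 1) continuous_const hb ha.ne'
      (b := -I) (by simp)).const_mul (a + I)
  have hi2 : Integrable fun x : ℝ => 2 * I * (((x : ℂ) - I)⁻¹ * ((x : ℂ) - -I)⁻¹) := by
    simpa using (integrable_mul_inv_mul_inv (f := fun _ => 1) continuous_const hb
      (a := I) (by simp) (b := -I) (by simp)).const_mul (2 * I)
  have hdiff : (∫ x : ℝ, (a + I) * (((x : ℂ) - a)⁻¹ * ((x : ℂ) - -I)⁻¹)) -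
      ∫ x : ℝ, 2 * I * (((x : ℂ) - I)⁻¹ * ((x : ℂ) - -I)⁻¹) =
      ∫ x : ℝ, (a - I) * (((x : ℂ) - a)⁻¹ * ((x : ℂ) - I)⁻¹) := by
    rw [← integral_sub hi1 hi2]
    congr 1 with x
    have h1 : (x : ℂ) - a ≠ 0 := fun h => ha.ne' (by simpa using congrArg Complex.im h)
    have h2 : (x : ℂ) - I ≠ 0 := fun h => by simpa using congrArg Complex.im h
    have h3 : (x : ℂ) - -I ≠ 0 := fun h => by simpa using congrArg Complex.im h
    field_simp
    ring
  rw [integral_const_mul, integral_const_mul, integral_const_mul, hzero,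
    integral_inv_sub_I_mul_inv_add_I] at hdiff
  linear_combination hdiff

lemma integrable_mul_herglotzKernel {f : ℂ → ℂ} {M : ℝ} (hf : Continuous f)
    (hb : ∀ z : ℂ, 0 ≤ z.im → ‖f z‖ ≤ M) {z : ℂ} (hz : 0 < z.im) :
    Integrable fun x : ℝ => f x * herglotzKernel z x := by
  have h1 := (integrable_mul_inv_mul_inv hf hb hz.ne' (b := -I) (by simp)).const_mul (z + I)
  have h2 := (integrable_mul_inv_mul_inv hf hb (a := I) (by simp)
    (b := -I) (by simp)).const_mul I
  refine (h1.sub h2).congr (.of_forall fun x => ?_)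
  simp only [Pi.sub_apply, herglotzKernel_eq hz]
  ring

lemma integral_mul_herglotzKernel {f : ℂ → ℂ} {M : ℝ} (hf : Differentiable ℂ f)
    (hb : ∀ z : ℂ, 0 ≤ z.im → ‖f z‖ ≤ M) {z : ℂ} (hz : 0 < z.im) :
    ∫ x : ℝ, f x * herglotzKernel z x = π * I * (2 * f z - f I) := by
  have h1 := (integrable_mul_inv_mul_inv hf.continuous hb hz.ne'
    (b := -I) (by simp)).const_mul (z + I)
  have h2 := (integrable_mul_inv_mul_inv hf.continuous hb (a := I) (by simp)
    (b := -I) (by simp)).const_mul I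
  have hsplit : ∫ x : ℝ, f x * herglotzKernel z x =
      (∫ x : ℝ, (z + I) * (f x * (((x : ℂ) - z)⁻¹ * ((x : ℂ) - -I)⁻¹))) -
      ∫ x : ℝ, I * (f x * (((x : ℂ) - I)⁻¹ * ((x : ℂ) - -I)⁻¹)) := by
    rw [← integral_sub h1 h2]
    congr 1 with x
    rw [herglotzKernel_eq hz]
    ring
  rw [hsplit, integral_const_mul, integral_const_mul,
    integral_mul_inv_mul_inv_eq_mul hf hb hz (by simp),
    integral_mul_inv_mul_inv_eq_mul hf hb (a := I) (by simp) (by simp),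
    integral_inv_sub_I_mul_inv_add_I]
  linear_combination f z * integral_inv_sub_mul_inv_add_I hz

lemma integrable_mul_herglotzKernel_neg {f : ℂ → ℂ} {M : ℝ} (hf : Continuous f)
    (hb : ∀ z : ℂ, 0 ≤ z.im → ‖f z‖ ≤ M) {z : ℂ} (hz : 0 < z.im) :
    Integrable fun x : ℝ => f x * herglotzKernel z (-x) := by
  have h1 := (integrable_mul_inv_mul_inv hf hb (a := -z) (by simpa using hz.ne')
    (b := -I) (by simp)).const_mul (z - I)
  have h2 := (integrable_mul_inv_mul_inv hf hb (a := I) (by simp)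
    (b := -I) (by simp)).const_mul I
  refine (h1.add h2).congr (.of_forall fun x => ?_)
  simp only [Pi.add_apply, herglotzKernel_neg_eq hz]
  ring

lemma integral_mul_herglotzKernel_neg {f : ℂ → ℂ} {M : ℝ} (hf : Differentiable ℂ f)
    (hb : ∀ z : ℂ, 0 ≤ z.im → ‖f z‖ ≤ M) {z : ℂ} (hz : 0 < z.im) :
    ∫ x : ℝ, f x * herglotzKernel z (-x) = π * I * f I := by
  have h1 := (integrable_mul_inv_mul_inv hf.continuous hb (a := -z) (by simpa using hz.ne')
    (b := -I) (by simp)).const_mul (z - I)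
  have h2 := (integrable_mul_inv_mul_inv hf.continuous hb (a := I) (by simp)
    (b := -I) (by simp)).const_mul I
  have hsplit : ∫ x : ℝ, f x * herglotzKernel z (-x) =
      (∫ x : ℝ, (z - I) * (f x * (((x : ℂ) - -z)⁻¹ * ((x : ℂ) - -I)⁻¹))) +
      ∫ x : ℝ, I * (f x * (((x : ℂ) - I)⁻¹ * ((x : ℂ) - -I)⁻¹)) := by
    rw [← integral_add h1 h2]
    congr 1 with x
    rw [herglotzKernel_neg_eq hz]
    ring
  rw [hsplit, integral_const_mul, integral_const_mul,
    integral_mul_inv_mul_inv_eq_zero hf hb (by simpa using hz) (by simp),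
    integral_mul_inv_mul_inv_eq_mul hf hb (a := I) (by simp) (by simp),
    integral_inv_sub_I_mul_inv_add_I]
  ring

lemma integral_herglotz_one_add_sin {z : ℂ} (hz : 0 < z.im) :
    ∫ l : ℝ, ((l : ℂ) * z + 1) / ((l : ℂ) - z) *
      (((1 + Real.sin l) / (π * (1 + l ^ 2)) : ℝ) : ℂ) =
      I + Complex.exp (I * z) - (Real.exp (-1) : ℂ) := by
  have hone : ∀ w : ℂ, 0 ≤ w.im → ‖(1 : ℂ)‖ ≤ 1 := fun _ _ => by simp
  have hexp : ∀ w : ℂ, 0 ≤ w.im → ‖Complex.exp (I * w)‖ ≤ 1 := fun w hw => by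
    simpa [Complex.norm_exp] using hw
  have hd : Differentiable ℂ fun w : ℂ => Complex.exp (I * w) := by fun_prop
  have hi1 := integrable_mul_herglotzKernel (f := fun _ => 1) continuous_const hone hz
  have hi2 := integrable_mul_herglotzKernel hd.continuous hexp hz
  have hi3 := (integrable_mul_herglotzKernel_neg hd.continuous hexp hz).comp_neg
  have hi4 : Integrable fun l : ℝ => (2 * I)⁻¹ * (Complex.exp (I * l) * herglotzKernel z l -
      Complex.exp (I * ((-l : ℝ) : ℂ)) * herglotzKernel z (- -l)) := (hi2.sub hi3).const_mul _
  have hI1 := integral_mul_herglotzKernel (differentiable_const (1 : ℂ)) hone hz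
  have hI2 := integral_mul_herglotzKernel hd hexp hz
  have hI3 := integral_mul_herglotzKernel_neg hd hexp hz
  rw [← integral_neg_eq_self] at hI3
  have hII : Complex.exp (I * I) = (Real.exp (-1) : ℂ) := by
    rw [I_mul_I]
    push_cast
    rfl
  have hpi : (π : ℂ) ≠ 0 := ofReal_ne_zero.2 pi_ne_zero
  calc _ = ∫ l : ℝ, (π : ℂ)⁻¹ * (1 * herglotzKernel z l +
        (2 * I)⁻¹ * (Complex.exp (I * l) * herglotzKernel z l -
          Complex.exp (I * ((-l : ℝ) : ℂ)) * herglotzKernel z (- -l))) := by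
        congr 1 with l
        have hsin : Complex.sin l =
            (2 * I)⁻¹ * (Complex.exp (I * l) - Complex.exp (I * ((-l : ℝ) : ℂ))) := by
          rw [Complex.sin, ofReal_neg, mul_comm I, mul_comm I, mul_inv, inv_I]
          ring
        rw [neg_neg, herglotzKernel]
        push_cast [hsin]
        rw [div_eq_mul_inv (1 + _), mul_inv (π : ℂ)]
        ring
    _ = (π : ℂ)⁻¹ * (π * I * (2 * 1 - 1) + (2 * I)⁻¹ *
        (π * I * (2 * Complex.exp (I * z) - Complex.exp (I * I)) -
          π * I * Complex.exp (I * I))) := by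
        rw [integral_const_mul, integral_add hi1 hi4, hI1, integral_const_mul,
          integral_sub hi2 hi3, hI2, hI3]
    _ = _ := by
        rw [hII]
        have := I_ne_zero
        field_simp
        ring

/-- For the probability density `(1+sin λ)/(π(1+λ²))`, the associated Herglotz function
`F(z) = ∫ (λz+1)/(λ−z) · (1+sin λ)/(π(1+λ²)) dλ` equals `i + e^{iz} − e^{−1}` on the
upper half-plane; in particular `F` has period `2π`. -/
theorem stmt_4 (F : ℂ → ℂ)
    (hF : ∀ z : ℂ, 0 < z.im →
      F z = ∫ l : ℝ, ((l : ℂ) * z + 1) / ((l : ℂ) - z) *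
        (((1 + Real.sin l) / (π * (1 + l ^ 2)) : ℝ) : ℂ)) :
    (∀ z : ℂ, 0 < z.im → F z = I + Complex.exp (I * z) - (Real.exp (-1) : ℂ)) ∧
      ∀ z : ℂ, 0 < z.im → F (z + (2 * π : ℝ)) = F z := by
  have hmain : ∀ z : ℂ, 0 < z.im → F z = I + Complex.exp (I * z) - (Real.exp (-1) : ℂ) :=
    fun z hz => (hF z hz).trans (integral_herglotz_one_add_sin hz)
  refine ⟨hmain, fun z hz => ?_⟩
  rw [hmain z hz, hmain _ (by simpa using hz)]
  have : I * (z + (2 * π : ℝ)) = I * z + 2 * π * I := by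
    push_cast
    ring
  rw [this, Complex.exp_periodic]
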